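/- arXiv:1906.11008 — 7 statements merged into one kernel-verified Lean document; each statement's English description precedes it below -/
import Mathlib

section
/- Let d = 2 or d = 3, let M ≥ 1, and let φ_1, …, φ_M : ℝ^d → ℝ^d be continuously differentiable maps such that for every m ∈ {1,…,M}, every i ∈ {1,…,d}, and every X ∈ ℝ^d with X_i = 0 or X_i = 1, the i-th component of φ_m(X) equals 0. For a ∈ ℝ^M set Ψ_a(X) = X + Σ_{m=1}^M a_m φ_m(X). If ā ∈ ℝ^M is such that det DΨ_ā(X) > 0 for every X in the closed unit cube [0,1]^d, then Ψ_ā maps the open unit cube (0,1)^d bijectively onto (0,1)^d. -/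
open Set Filter Topology

section UnitCube

variable {ι : Type*}

/-- The closed unit cube. -/
def closedUnitCube (ι : Type*) : Set (EuclideanSpace ℝ ι) := {X | ∀ i, X i ∈ Icc (0 : ℝ) 1}

/-- The open unit cube. -/
def openUnitCube (ι : Type*) : Set (EuclideanSpace ℝ ι) := {X | ∀ i, X i ∈ Ioo (0 : ℝ) 1}

lemma openUnitCube_subset_closedUnitCube : openUnitCube ι ⊆ closedUnitCube ι :=
  fun _ hX i => Ioo_subset_Icc_self (hX i)

lemma isOpen_openUnitCube [Finite ι] : IsOpen (openUnitCube ι) := by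
  simp only [openUnitCube, ofPred_forall]
  exact isOpen_iInter_of_finite fun i =>
    isOpen_Ioo.preimage (by fun_prop : Continuous fun X : EuclideanSpace ℝ ι => X i)

lemma convex_openUnitCube : Convex ℝ (openUnitCube ι) := by
  intro x hx y hy a b ha hb hab i
  exact convex_Ioo (0 : ℝ) 1 (hx i) (hy i) ha hb hab

lemma openUnitCube_nonempty : (openUnitCube ι).Nonempty :=
  ⟨WithLp.toLp 2 fun _ => 1 / 2, fun i => by norm_num⟩

lemma isCompact_closedUnitCube : IsCompact (closedUnitCube ι) := by
  have h : IsCompact (univ.pi fun _ : ι => Icc (0 : ℝ) 1) :=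
    isCompact_univ_pi fun _ => isCompact_Icc
  convert h.image (PiLp.continuous_toLp 2 fun _ : ι => ℝ) using 1
  ext X
  constructor
  · intro hX
    exact ⟨WithLp.ofLp X, fun i _ => hX i, rfl⟩
  · rintro ⟨Y, hY, rfl⟩ i
    exact hY i (mem_univ i)

lemma zero_mem_closure_openUnitCube [Finite ι] : (0 : EuclideanSpace ℝ ι) ∈ closure (openUnitCube ι) := by
  have := Fintype.ofFinite ι
  let c : EuclideanSpace ℝ ι := WithLp.toLp 2 fun _ => 1
  have hc : Tendsto (fun t : ℝ => t • c) (𝓝[>] 0) (𝓝 0) := by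
    have : Continuous fun t : ℝ => t • c := by fun_prop
    simpa using (this.tendsto 0).mono_left nhdsWithin_le_nhds
  refine mem_closure_of_tendsto hc ?_
  filter_upwards [Ioo_mem_nhdsGT (zero_lt_one' ℝ)] with t ht i
  simpa [c] using ht

variable [Fintype ι] {f : EuclideanSpace ℝ ι → EuclideanSpace ℝ ι}

/-- A component of `f` which is constant on a coordinate hyperplane has a derivative that only
depends on the corresponding coordinate of the direction. -/
lemma fderiv_apply_eq_zero_of_face (hf : ContDiff ℝ 1 f)
    (hbc : ∀ i (X : EuclideanSpace ℝ ι), X i = 0 ∨ X i = 1 → f X i = X i)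
    {X w : EuclideanSpace ℝ ι} {k : ι} (hX : X k = 0 ∨ X k = 1) (hw : w k = 0) :
    fderiv ℝ f X w k = 0 := by
  have h1 : HasDerivAt (fun t : ℝ => f (X + t • w)) (fderiv ℝ f X w) 0 :=
    ((hf.differentiable one_ne_zero X).hasFDerivAt.hasLineDerivAt w)
  have h2 : HasDerivAt (fun t : ℝ => f (X + t • w) k) (fderiv ℝ f X w k) 0 :=
    (EuclideanSpace.proj (𝕜 := ℝ) k).hasFDerivAt.comp_hasDerivAt (0 : ℝ) h1
  have h3 : (fun t : ℝ => f (X + t • w) k) = fun _ => X k := by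
    funext t
    have : (X + t • w) k = X k := by simp [hw]
    rw [hbc k _ (by rwa [this]), this]
  rw [h3] at h2
  exact h2.unique (hasDerivAt_const _ _)

lemma exists_fderiv_eq_single [DecidableEq ι] (hf : ContDiff ℝ 1 f)
    (hbc : ∀ i (X : EuclideanSpace ℝ ι), X i = 0 ∨ X i = 1 → f X i = X i)
    {X : EuclideanSpace ℝ ι} (hsurj : Function.Surjective (fderiv ℝ f X)) {i : ι}
    (hi : X i ∈ Ioo (0 : ℝ) 1) :
    ∃ v, fderiv ℝ f X v = EuclideanSpace.single i 1 ∧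
      ∀ k, X k = 0 ∨ X k = 1 → v k = 0 := by
  obtain ⟨v, hv⟩ := hsurj (EuclideanSpace.single i 1)
  refine ⟨v, hv, fun k hk => ?_⟩
  have key : ∀ w, fderiv ℝ f X w k = w k * fderiv ℝ f X (EuclideanSpace.single k 1) k := by
    intro w
    have := fderiv_apply_eq_zero_of_face hf hbc (w := w - w k • EuclideanSpace.single k 1) hk
      (by simp)
    simp only [map_sub, map_smul, PiLp.sub_apply, PiLp.smul_apply, smul_eq_mul] at this
    linarith
  obtain ⟨u, hu⟩ := hsurj (EuclideanSpace.single k 1)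
  have h1 := key u
  have h2 := key v
  have hki : k ≠ i := by
    rintro rfl
    rcases hk with hk | hk <;> simp [hk] at hi
  simp only [hu, hv, PiLp.single_apply, hki, if_true, if_false] at h1 h2
  rcases mul_eq_zero.1 h2.symm with h | h
  · exact h
  · simp [h] at h1

lemma not_isExtrOn_apply (hf : ContDiff ℝ 1 f)
    (hbc : ∀ i (X : EuclideanSpace ℝ ι), X i = 0 ∨ X i = 1 → f X i = X i)
    {X : EuclideanSpace ℝ ι} (hX : X ∈ closedUnitCube ι)
    (hsurj : Function.Surjective (fderiv ℝ f X)) {i : ι}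
    (hi : X i ∈ Ioo (0 : ℝ) 1) : ¬ IsExtrOn (fun Y => f Y i) (closedUnitCube ι) X := by
  classical
  intro hext
  obtain ⟨v, hv, hvk⟩ := exists_fderiv_eq_single hf hbc hsurj hi
  have h1 : HasDerivAt (fun t : ℝ => f (X + t • v)) (fderiv ℝ f X v) 0 :=
    ((hf.differentiable one_ne_zero X).hasFDerivAt.hasLineDerivAt v)
  have h2 : HasDerivAt (fun t : ℝ => f (X + t • v) i) (fderiv ℝ f X v i) 0 :=
    (EuclideanSpace.proj (𝕜 := ℝ) i).hasFDerivAt.comp_hasDerivAt (0 : ℝ) h1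
  have hmem : ∀ᶠ t : ℝ in 𝓝 0, X + t • v ∈ closedUnitCube ι := by
    refine eventually_all.2 fun k => ?_
    by_cases hk : X k = 0 ∨ X k = 1
    · refine Eventually.of_forall fun t => ?_
      simpa [hvk k hk] using hX k
    · have hk' : X k ∈ Ioo (0 : ℝ) 1 := by
        push Not at hk
        exact ⟨lt_of_le_of_ne (hX k).1 (Ne.symm hk.1), lt_of_le_of_ne (hX k).2 hk.2⟩
      have hc : Continuous fun t : ℝ => (X + t • v) k := by fun_prop
      filter_upwards [hc.continuousAt.eventually_mem
        (isOpen_Ioo.mem_nhds (by simpa using hk' : (X + (0 : ℝ) • v) k ∈ Ioo (0 : ℝ) 1))]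
        with t ht using Ioo_subset_Icc_self ht
  have h3 : IsLocalExtr (fun t : ℝ => f (X + t • v) i) 0 := by
    rcases hext with h | h
    · exact Or.inl (hmem.mono fun t ht => by simpa using h ht)
    · exact Or.inr (hmem.mono fun t ht => by simpa using h ht)
  have h4 := h3.hasDerivAt_eq_zero h2
  simp [hv] at h4

lemma mapsTo_closedUnitCube (hf : ContDiff ℝ 1 f)
    (hbc : ∀ i (X : EuclideanSpace ℝ ι), X i = 0 ∨ X i = 1 → f X i = X i)
    (hsurj : ∀ X ∈ closedUnitCube ι, Function.Surjective (fderiv ℝ f X)) :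
    MapsTo f (closedUnitCube ι) (closedUnitCube ι) := by
  intro X hX i
  have hc : Continuous fun Y => f Y i := by
    have := hf.continuous
    fun_prop
  have hend : ∀ Z ∈ closedUnitCube ι, IsExtrOn (fun Y => f Y i) (closedUnitCube ι) Z →
      f Z i ∈ Icc (0 : ℝ) 1 := by
    intro Z hZ hext
    by_cases hZi : Z i = 0 ∨ Z i = 1
    · rw [hbc i Z hZi]
      exact hZ i
    · push Not at hZi
      exact absurd hext (not_isExtrOn_apply hf hbc hZ (hsurj Z hZ)
        ⟨lt_of_le_of_ne (hZ i).1 (Ne.symm hZi.1), lt_of_le_of_ne (hZ i).2 hZi.2⟩)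
  obtain ⟨Z, hZ, hmin⟩ := isCompact_closedUnitCube.exists_isMinOn ⟨X, hX⟩ hc.continuousOn
  obtain ⟨W, hW, hmax⟩ := isCompact_closedUnitCube.exists_isMaxOn ⟨X, hX⟩ hc.continuousOn
  exact ⟨(hend Z hZ (Or.inl hmin)).1.trans (hmin hX), (hmax hX).trans (hend W hW (Or.inr hmax)).2⟩

lemma apply_mem_Ioo_iff (hf : ContDiff ℝ 1 f)
    (hbc : ∀ i (X : EuclideanSpace ℝ ι), X i = 0 ∨ X i = 1 → f X i = X i)
    (hsurj : ∀ X ∈ closedUnitCube ι, Function.Surjective (fderiv ℝ f X))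
    {X : EuclideanSpace ℝ ι} (hX : X ∈ closedUnitCube ι) (i : ι) :
    f X i ∈ Ioo (0 : ℝ) 1 ↔ X i ∈ Ioo (0 : ℝ) 1 := by
  have hQ := mapsTo_closedUnitCube hf hbc hsurj
  constructor
  · intro h
    by_contra hi
    have hi' : X i = 0 ∨ X i = 1 := by
      by_contra! hne
      exact hi ⟨lt_of_le_of_ne (hX i).1 (Ne.symm hne.1), lt_of_le_of_ne (hX i).2 hne.2⟩
    rw [hbc i X hi'] at h
    exact hi h
  · intro hi
    have hne := not_isExtrOn_apply hf hbc hX (hsurj X hX) hi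
    refine ⟨lt_of_le_of_ne (hQ hX i).1 fun h => hne (Or.inl fun Y hY => ?_),
      lt_of_le_of_ne (hQ hX i).2 fun h => hne (Or.inr fun Y hY => ?_)⟩
    · exact h.symm.le.trans (hQ hY i).1
    · exact (hQ hY i).2.trans h.ge

lemma mem_openUnitCube_of_apply_mem (hf : ContDiff ℝ 1 f)
    (hbc : ∀ i (X : EuclideanSpace ℝ ι), X i = 0 ∨ X i = 1 → f X i = X i)
    (hsurj : ∀ X ∈ closedUnitCube ι, Function.Surjective (fderiv ℝ f X))
    {X : EuclideanSpace ℝ ι} (hX : X ∈ closedUnitCube ι) (h : f X ∈ openUnitCube ι) :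
    X ∈ openUnitCube ι :=
  fun i => (apply_mem_Ioo_iff hf hbc hsurj hX i).1 (h i)

lemma eq_zero_of_apply_eq_zero (hf : ContDiff ℝ 1 f)
    (hbc : ∀ i (X : EuclideanSpace ℝ ι), X i = 0 ∨ X i = 1 → f X i = X i)
    (hsurj : ∀ X ∈ closedUnitCube ι, Function.Surjective (fderiv ℝ f X))
    {X : EuclideanSpace ℝ ι} (hX : X ∈ closedUnitCube ι) (h : f X = 0) : X = 0 := by
  ext i
  by_contra hi
  have h0 : f X i = 0 := by simp [h]
  have h1 : X i ≠ 1 := fun h1 => by simp [hbc i X (Or.inr h1), h1] at h0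
  have := (apply_mem_Ioo_iff hf hbc hsurj hX i).2
    ⟨lt_of_le_of_ne (hX i).1 (Ne.symm hi), lt_of_le_of_ne (hX i).2 h1⟩
  simp [h0] at this

/-- The values in the closed unit cube that are attained at least twice form a compact set. -/
lemma isCompact_setOf_multiple_values (hf : ContDiff ℝ 1 f)
    (hinv : ∀ X ∈ closedUnitCube ι, Function.Bijective (fderiv ℝ f X)) :
    IsCompact {y | ∃ X ∈ closedUnitCube ι, ∃ X' ∈ closedUnitCube ι,
      X ≠ X' ∧ f X = y ∧ f X' = y} := by
  let K : Set (EuclideanSpace ℝ ι × EuclideanSpace ℝ ι) :=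
    {p | p ∈ closedUnitCube ι ×ˢ closedUnitCube ι ∧ p.1 ≠ p.2 ∧ f p.1 = f p.2}
  have hcont := hf.continuous
  have hclosed : IsClosed K := by
    rw [← isOpen_compl_iff, isOpen_iff_mem_nhds]
    rintro ⟨X, X'⟩ hp
    by_cases hQ : (X, X') ∈ closedUnitCube ι ×ˢ closedUnitCube ι
    · by_cases hfe : f X = f X'
      · have hXX' : X = X' := by
          by_contra hne
          exact hp ⟨hQ, hne, hfe⟩
        subst hXX'
        let e := ContinuousLinearEquiv.ofBijective (fderiv ℝ f X)
          (LinearMap.ker_eq_bot.2 (hinv X hQ.1).1) (LinearMap.range_eq_top.2 (hinv X hQ.1).2)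
        have he : HasStrictFDerivAt f (e : EuclideanSpace ℝ ι →L[ℝ] EuclideanSpace ℝ ι) X := by
          exact hf.contDiffAt.hasStrictFDerivAt one_ne_zero
        have hs : (he.toOpenPartialHomeomorph f).source ∈ 𝓝 X :=
          (he.toOpenPartialHomeomorph f).open_source.mem_nhds he.mem_toOpenPartialHomeomorph_source
        filter_upwards [prod_mem_nhds hs hs] with q hq hqK
        exact hqK.2.1 ((he.toOpenPartialHomeomorph f).injOn hq.1 hq.2 hqK.2.2)
      · have : IsOpen {q : EuclideanSpace ℝ ι × EuclideanSpace ℝ ι | f q.1 ≠ f q.2} :=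
          isOpen_ne_fun (by fun_prop) (by fun_prop)
        filter_upwards [this.mem_nhds hfe] with q hq hqK using hq hqK.2.2
    · have : IsClosed (closedUnitCube ι ×ˢ closedUnitCube ι) :=
        isCompact_closedUnitCube.isClosed.prod isCompact_closedUnitCube.isClosed
      filter_upwards [this.isOpen_compl.mem_nhds hQ] with q hq hqK using hq hqK.1
  have hKc : IsCompact K :=
    (isCompact_closedUnitCube.prod isCompact_closedUnitCube).of_isClosed_subset hclosed
      fun p hp => hp.1
  refine (congrArg IsCompact (Set.ext fun y => ?_)).mpr (hKc.image (hcont.comp continuous_fst))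
  constructor
  · rintro ⟨X, hX, X', hX', hne, h, h'⟩
    exact ⟨(X, X'), ⟨⟨hX, hX'⟩, hne, h.trans h'.symm⟩, h⟩
  · rintro ⟨⟨X, X'⟩, ⟨⟨hX, hX'⟩, hne, h⟩, rfl⟩
    exact ⟨X, hX, X', hX', hne, rfl, h.symm⟩

/-- A compact set whose trace on the open unit cube is open and nonempty contains the cube. -/
lemma openUnitCube_subset_of_isCompact {B : Set (EuclideanSpace ℝ ι)} (hB : IsCompact B)
    (ho : ∀ y ∈ B, y ∈ openUnitCube ι → B ∈ 𝓝 y) (hne : (B ∩ openUnitCube ι).Nonempty) :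
    openUnitCube ι ⊆ B := by
  have h := convex_openUnitCube (ι := ι).isPreconnected.subset_of_closure_inter_subset
    (u := interior B) isOpen_interior
    (by
      obtain ⟨y, hy, hyU⟩ := hne
      exact ⟨y, hyU, mem_interior_iff_mem_nhds.2 (ho y hy hyU)⟩)
    (fun y hy => mem_interior_iff_mem_nhds.2
      (ho y (hB.isClosed.closure_subset_iff.2 interior_subset hy.1) hy.2))
  exact h.trans interior_subset

theorem bijOn_openUnitCube (hf : ContDiff ℝ 1 f)
    (hbc : ∀ i (X : EuclideanSpace ℝ ι), X i = 0 ∨ X i = 1 → f X i = X i)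
    (hinv : ∀ X ∈ closedUnitCube ι, Function.Bijective (fderiv ℝ f X)) :
    BijOn f (openUnitCube ι) (openUnitCube ι) := by
  have hsurj : ∀ X ∈ closedUnitCube ι, Function.Surjective (fderiv ℝ f X) :=
    fun X hX => (hinv X hX).2
  have hmaps : MapsTo f (openUnitCube ι) (openUnitCube ι) := fun X hX i =>
    (apply_mem_Ioo_iff hf hbc hsurj (openUnitCube_subset_closedUnitCube hX) i).2 (hX i)
  have hopen : ∀ X ∈ closedUnitCube ι, ∀ s ∈ 𝓝 X, f '' s ∈ 𝓝 (f X) := by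
    intro X hX s hs
    rw [← (hf.contDiffAt.hasStrictFDerivAt one_ne_zero).map_nhds_eq_of_surj
      (LinearMap.range_eq_top.2 (hsurj X hX))]
    exact image_mem_map hs
  have hU : ∀ X ∈ closedUnitCube ι, f X ∈ openUnitCube ι → closedUnitCube ι ∈ 𝓝 X :=
    fun X hX h => mem_of_superset
      (isOpen_openUnitCube.mem_nhds (mem_openUnitCube_of_apply_mem hf hbc hsurj hX h))
      openUnitCube_subset_closedUnitCube
  refine ⟨hmaps, fun X hX X' hX' h => ?_, fun y hy => ?_⟩
  · by_contra hne
    have hsub := openUnitCube_subset_of_isCompact (isCompact_setOf_multiple_values hf hinv)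
      (by
        rintro y ⟨Z, hZ, Z', hZ', hZne, rfl, hy⟩ hyU
        obtain ⟨s, s', hs, hs', hss'⟩ := t2_separation_nhds hZne
        filter_upwards [hopen Z hZ _ (inter_mem hs (hU Z hZ hyU)),
          hy ▸ hopen Z' hZ' _ (inter_mem hs' (hU Z' hZ' (by rwa [hy])))]
        rintro _ ⟨W, hW, rfl⟩ ⟨W', hW', hWW'⟩
        exact ⟨W, hW.2, W', hW'.2, hss'.ne_of_mem hW.1 hW'.1, rfl, hWW'⟩)
      ⟨f X, ⟨X, openUnitCube_subset_closedUnitCube hX, X',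
        openUnitCube_subset_closedUnitCube hX', hne, rfl, h.symm⟩, hmaps hX⟩
    obtain ⟨Z, hZ, Z', hZ', hZne, h0, h0'⟩ :=
      (isCompact_setOf_multiple_values hf hinv).isClosed.closure_subset_iff.2 hsub
        zero_mem_closure_openUnitCube
    exact hZne ((eq_zero_of_apply_eq_zero hf hbc hsurj hZ h0).trans
      (eq_zero_of_apply_eq_zero hf hbc hsurj hZ' h0').symm)
  · obtain ⟨X₀, hX₀⟩ := openUnitCube_nonempty (ι := ι)
    have hsub := openUnitCube_subset_of_isCompact
      (isCompact_closedUnitCube.image hf.continuous)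
      (by
        rintro _ ⟨Z, hZ, rfl⟩ hyU
        exact hopen Z hZ _ (hU Z hZ hyU))
      ⟨f X₀, mem_image_of_mem f (openUnitCube_subset_closedUnitCube hX₀), hmaps hX₀⟩
    obtain ⟨X, hX, rfl⟩ := hsub hy
    exact ⟨X, mem_openUnitCube_of_apply_mem hf hbc hsurj hX hy, rfl⟩

end UnitCube


/-- **Proposition 2.3, first part (th:application_unit_square).** For `d = 2` or `d = 3`,
if the `C¹` fields `φ_m` vanish in their `i`-th component on the faces `{X_i = 0}` and
`{X_i = 1}`, and `ā` is such that `det DΨ_ā > 0` on the closed unit cube, then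
`Ψ_ā(X) = X + ∑ m, ā_m φ_m(X)` maps the open unit cube bijectively onto itself. -/
theorem stmt_2 (d M : ℕ) (hd : d = 2 ∨ d = 3) (hM : 1 ≤ M)
    (φ : Fin M → EuclideanSpace ℝ (Fin d) → EuclideanSpace ℝ (Fin d))
    (hφreg : ∀ m, ContDiff ℝ 1 (φ m))
    (hφbc : ∀ m i (X : EuclideanSpace ℝ (Fin d)), X i = 0 ∨ X i = 1 → φ m X i = 0)
    (a : Fin M → ℝ)
    (hdet : ∀ X : EuclideanSpace ℝ (Fin d), (∀ i, X i ∈ Set.Icc (0 : ℝ) 1) →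
      0 < (fderiv ℝ (fun Y => Y + ∑ m, a m • φ m Y) X).det) :
    Set.BijOn (fun Y => Y + ∑ m, a m • φ m Y)
      {X : EuclideanSpace ℝ (Fin d) | ∀ i, X i ∈ Set.Ioo (0 : ℝ) 1}
      {X : EuclideanSpace ℝ (Fin d) | ∀ i, X i ∈ Set.Ioo (0 : ℝ) 1} := by
  refine bijOn_openUnitCube (ι := Fin d) ?_ ?_ ?_
  · exact contDiff_id.add (ContDiff.sum fun m _ => (hφreg m).const_smul (a m))
  · intro i X hX
    simp [hφbc _ i X hX]
  · intro X hX
    have h : IsUnit (fderiv ℝ (fun Y => Y + ∑ m, a m • φ m Y) X).toLinearMap :=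
      (LinearMap.isUnit_iff_isUnit_det _).2 (hdet X hX).ne'.isUnit
    exact (Module.End.isUnit_iff _).1 h
end

section
/- Let Φ = (Φ₁, Φ₂) : ℝ² → ℝ² be continuously differentiable. Assume that Φ₂(t, 1) = 1 for every t ∈ [0,1], that Φ₁(0,1) = 0 and Φ₁(1,1) = 1, and that det DΦ(t,1) > 0 for every t ∈ [0,1]. Then 0 ≤ Φ₁(t,1) ≤ 1 for every t ∈ [0,1], i.e. Φ maps the top edge {(t,1) : t ∈ [0,1]} of the unit square into itself. -/
/-- A linear endomorphism with positive determinant does not kill a nonzero vector. -/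
theorem ContinuousLinearMap.apply_ne_zero_of_det_pos {E : Type*} [NormedAddCommGroup E]
    [NormedSpace ℝ E] [FiniteDimensional ℝ E] {A : E →L[ℝ] E} (hA : 0 < A.det)
    {v : E} (hv : v ≠ 0) : A v ≠ 0 :=
  fun h => hv <| (LinearMap.equivOfDetNeZero (A : E →ₗ[ℝ] E) hA.ne').injective <| by
    simpa using h

/-- If the second component of `Φ` is locally constant along a horizontal line and `DΦ` has
positive determinant, then the first component has no local extremum along that line. -/
theorem not_isLocalExtr_fst_of_det_pos {Φ : ℝ × ℝ → ℝ × ℝ} {t y c : ℝ}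
    (hΦ : DifferentiableAt ℝ Φ (t, y)) (hsnd : ∀ᶠ s in nhds t, (Φ (s, y)).2 = c)
    (hdet : 0 < (fderiv ℝ Φ (t, y)).det) : ¬ IsLocalExtr (fun s => (Φ (s, y)).1) t := by
  intro hext
  have hcurve : HasDerivAt (fun s => Φ (s, y)) (fderiv ℝ Φ (t, y) (1, 0)) t :=
    hΦ.hasFDerivAt.comp_hasDerivAt t ((hasDerivAt_id t).prodMk (hasDerivAt_const t y))
  have hfst : (fderiv ℝ Φ (t, y) (1, 0)).1 = 0 :=
    hext.hasDerivAt_eq_zero ((ContinuousLinearMap.fst ℝ ℝ ℝ).hasFDerivAt.comp_hasDerivAt t hcurve)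
  have hsnd' : (fderiv ℝ Φ (t, y) (1, 0)).2 = 0 :=
    ((ContinuousLinearMap.snd ℝ ℝ ℝ).hasFDerivAt.comp_hasDerivAt t hcurve).unique
      ((hasDerivAt_const t c).congr_of_eventuallyEq hsnd)
  exact ContinuousLinearMap.apply_ne_zero_of_det_pos hdet (by simp) (Prod.ext hfst hsnd')

/-- **Edge-preservation claim from the proof of Proposition 2.3.** Let `Φ : ℝ² → ℝ²` be
`C¹` with `Φ₂(t,1) = 1` for `t ∈ [0,1]`, `Φ₁(0,1) = 0`, `Φ₁(1,1) = 1`, and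
`det DΦ(t,1) > 0` for `t ∈ [0,1]`. Then `Φ₁(t,1) ∈ [0,1]` for every `t ∈ [0,1]`,
i.e. `Φ` maps the top edge of the unit square into itself. -/
theorem stmt_5 (Φ : ℝ × ℝ → ℝ × ℝ) (hΦ : ContDiff ℝ 1 Φ)
    (htop : ∀ t ∈ Set.Icc (0 : ℝ) 1, (Φ (t, 1)).2 = 1)
    (h0 : (Φ ((0 : ℝ), (1 : ℝ))).1 = 0)
    (h1 : (Φ ((1 : ℝ), (1 : ℝ))).1 = 1)
    (hdet : ∀ t ∈ Set.Icc (0 : ℝ) 1, 0 < (fderiv ℝ Φ (t, 1)).det) :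
    ∀ t ∈ Set.Icc (0 : ℝ) 1, (Φ (t, 1)).1 ∈ Set.Icc (0 : ℝ) 1 := by
  have hcont : ContinuousOn (fun s : ℝ => (Φ (s, 1)).1) (Set.Icc 0 1) :=
    (hΦ.continuous.comp (by fun_prop : Continuous fun s : ℝ => (s, (1 : ℝ)))).fst.continuousOn
  have hint : ∀ s ∈ Set.Ioo (0 : ℝ) 1, ¬ IsLocalExtr (fun s => (Φ (s, 1)).1) s := by
    intro s hs
    refine not_isLocalExtr_fst_of_det_pos (hΦ.differentiable one_ne_zero _) (c := 1) ?_
      (hdet s (Set.Ioo_subset_Icc_self hs))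
    filter_upwards [Icc_mem_nhds hs.1 hs.2] with r hr using htop r hr
  have hends : ∀ s ∈ Set.Icc (0 : ℝ) 1, IsExtrOn (fun s => (Φ (s, 1)).1) (Set.Icc 0 1) s →
      (Φ (s, 1)).1 ∈ Set.Icc (0 : ℝ) 1 := by
    intro s hs hext
    rcases hs.1.eq_or_lt with rfl | hs0
    · simp [h0]
    rcases hs.2.eq_or_lt with rfl | hs1
    · simp [h1]
    exact absurd (hext.isLocalExtr (Icc_mem_nhds hs0 hs1)) (hint s ⟨hs0, hs1⟩)
  intro t ht
  obtain ⟨a, ha, hmin⟩ := isCompact_Icc.exists_isMinOn ⟨t, ht⟩ hcont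
  obtain ⟨b, hb, hmax⟩ := isCompact_Icc.exists_isMaxOn ⟨t, ht⟩ hcont
  exact ⟨(hends a ha hmin.isExtr).1.trans (hmin ht), (hmax ht).trans (hends b hb hmax.isExtr).2⟩
end

section
/- Let d ≥ 1, let f : ℝ^d → ℝ be a continuous convex function whose strict sublevel set Ω̂ = {x ∈ ℝ^d : f(x) < 0} is nonempty and bounded, and let δ > 0, ε > 0. Let Φ : ℝ^d → ℝ^d be continuously differentiable on the open δ-neighborhood of Ω̂, with det DΦ(X) ≥ ε for every X ∈ Ω̂, and suppose f(Φ(X)) ≤ 0 for every X in the frontier of Ω̂. Then f(Φ(X)) ≤ 0 for every X in the closure of Ω̂; in particular Φ maps the closure of Ω̂ into itself. -/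
/-- A local maximum of a convex function on the whole space is a global minimum. -/
theorem ConvexOn.le_of_isLocalMax {E : Type*} [AddCommGroup E] [Module ℝ E]
    [TopologicalSpace E] [IsTopologicalAddGroup E] [ContinuousSMul ℝ E]
    {f : E → ℝ} (hf : ConvexOn ℝ Set.univ f) {p : E} (hp : IsLocalMax f p) (q : E) :
    f p ≤ f q := by
  have hline : Filter.Tendsto (fun t : ℝ => p + t • (p - q)) (nhdsWithin 0 (Set.Ioi 0))
      (nhds p) := by
    have h : Continuous (fun t : ℝ => p + t • (p - q)) := by fun_prop
    simpa using (h.tendsto 0).mono_left nhdsWithin_le_nhds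
  obtain ⟨t, hmax, ht⟩ := ((hline.eventually hp).and self_mem_nhdsWithin).exists
  have ht : 0 < t := ht
  have hcomb : (t / (1 + t)) • q + (1 / (1 + t)) • (p + t • (p - q)) = p := by
    match_scalars <;> field_simp
    ring
  have hconv := hf.2 (Set.mem_univ q) (Set.mem_univ (p + t • (p - q)))
    (show 0 ≤ t / (1 + t) by positivity) (show 0 ≤ 1 / (1 + t) by positivity)
    (by field_simp; ring)
  rw [hcomb, smul_eq_mul, smul_eq_mul, div_mul_eq_mul_div, div_mul_eq_mul_div, ← add_div,
    le_div_iff₀ (by positivity)] at hconv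
  exact le_of_mul_le_mul_left (by linarith) ht

/-- If a convex function takes a value below `c`, then its sublevel set at height `c` lies in the
closure of its strict sublevel set. -/
theorem ConvexOn.mem_closure_lt {E : Type*} [AddCommGroup E] [Module ℝ E]
    [TopologicalSpace E] [IsTopologicalAddGroup E] [ContinuousSMul ℝ E]
    {f : E → ℝ} (hf : ConvexOn ℝ Set.univ f) {c : ℝ} {q y : E} (hq : f q < c) (hy : f y ≤ c) :
    y ∈ closure {x | f x < c} := by
  have hline : Filter.Tendsto (fun t : ℝ => (1 - t) • y + t • q) (nhdsWithin 0 (Set.Ioi 0))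
      (nhds y) := by
    have h : Continuous (fun t : ℝ => (1 - t) • y + t • q) := by fun_prop
    simpa using (h.tendsto 0).mono_left nhdsWithin_le_nhds
  refine mem_closure_of_tendsto hline ?_
  filter_upwards [Ioo_mem_nhdsGT (zero_lt_one' ℝ)] with t ht
  have hconv := hf.2 (Set.mem_univ y) (Set.mem_univ q) (sub_nonneg.2 ht.2.le) ht.1.le (by ring)
  simp only [smul_eq_mul] at hconv
  have h₁ := mul_le_mul_of_nonneg_left hy (sub_nonneg.2 ht.2.le)
  have h₂ := mul_lt_mul_of_pos_left hq ht.1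
  exact hconv.trans_lt (by linarith)

/-- If `f ∘ Φ` has a local maximum at `x`, and `Φ` is `C¹` at `x` with a derivative of nonzero
determinant, then `f` has a local maximum at `Φ x`. -/
theorem IsLocalMax.of_comp_of_det_ne_zero {E : Type*} [NormedAddCommGroup E] [NormedSpace ℝ E]
    [FiniteDimensional ℝ E] {f : E → ℝ} {Φ : E → E} {x : E}
    (hmax : IsLocalMax (f ∘ Φ) x) (hΦ : ContDiffAt ℝ 1 Φ x) (hdet : (fderiv ℝ Φ x).det ≠ 0) :
    IsLocalMax f (Φ x) := by
  have : CompleteSpace E := FiniteDimensional.complete ℝ E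
  have hstrict : HasStrictFDerivAt Φ
      ((fderiv ℝ Φ x).toContinuousLinearEquivOfDetNeZero hdet : E →L[ℝ] E) x :=
    hΦ.hasStrictFDerivAt one_ne_zero
  change ∀ᶠ y in nhds (Φ x), f y ≤ f (Φ x)
  rw [← hstrict.map_nhds_eq_of_equiv, Filter.eventually_map]
  exact hmax

/-- **Step 1 of the proof of Proposition 2.1.** Let `f : ℝ^d → ℝ` be continuous and
convex with nonempty bounded strict sublevel set `Ω̂ = {x | f x < 0}`. If `Φ` is `C¹` on
the open `δ`-neighborhood of `Ω̂`, `det DΦ ≥ ε > 0` on `Ω̂`, and `f ∘ Φ ≤ 0` on the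
frontier of `Ω̂`, then `f ∘ Φ ≤ 0` on the closure of `Ω̂`; in particular `Φ` maps the
closure of `Ω̂` into itself. -/
theorem stmt_6 (d : ℕ) (hd : 1 ≤ d)
    (f : EuclideanSpace ℝ (Fin d) → ℝ)
    (hf_cont : Continuous f)
    (hf_conv : ConvexOn ℝ Set.univ f)
    (hne : {x | f x < 0}.Nonempty)
    (hbdd : Bornology.IsBounded {x | f x < 0})
    (δ ε : ℝ) (hδ : 0 < δ) (hε : 0 < ε)
    (Φ : EuclideanSpace ℝ (Fin d) → EuclideanSpace ℝ (Fin d))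
    (hΦreg : ContDiffOn ℝ 1 Φ {x | Metric.infDist x {x | f x < 0} < δ})
    (hΦdet : ∀ X ∈ {x | f x < 0}, ε ≤ (fderiv ℝ Φ X).det)
    (hbnd : ∀ X ∈ frontier {x | f x < 0}, f (Φ X) ≤ 0) :
    (∀ X ∈ closure {x | f x < 0}, f (Φ X) ≤ 0) ∧
      Set.MapsTo Φ (closure {x | f x < 0}) (closure {x | f x < 0}) := by
  obtain ⟨q, hq⟩ := hne
  have hopen : IsOpen {x | f x < 0} := isOpen_lt hf_cont continuous_const
  have hnhd : IsOpen {x | Metric.infDist x {x | f x < 0} < δ} :=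
    isOpen_lt (Metric.continuous_infDist_pt _) continuous_const
  have hsub : closure {x | f x < 0} ⊆ {x | Metric.infDist x {x | f x < 0} < δ} := by
    intro x hx
    simpa [(Metric.mem_closure_iff_infDist_zero ⟨q, hq⟩).1 hx] using hδ
  have hle : ∀ X ∈ closure {x | f x < 0}, f (Φ X) ≤ 0 := by
    obtain ⟨X₀, hX₀, hmax⟩ := hbdd.isCompact_closure.exists_isMaxOn ⟨q, subset_closure hq⟩
      (hf_cont.comp_continuousOn (hΦreg.continuousOn.mono hsub))
    refine fun X hX => (hmax hX).trans ?_
    by_cases hfr : X₀ ∈ frontier {x | f x < 0}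
    · exact hbnd X₀ hfr
    have hX₀Ω : X₀ ∈ {x | f x < 0} := by
      by_contra h
      exact hfr (hopen.frontier_eq ▸ ⟨hX₀, h⟩)
    have hloc : IsLocalMax (f ∘ Φ) X₀ :=
      hmax.isLocalMax (Filter.mem_of_superset (hopen.mem_nhds hX₀Ω) subset_closure)
    have hlocf : IsLocalMax f (Φ X₀) :=
      hloc.of_comp_of_det_ne_zero (hΦreg.contDiffAt (hnhd.mem_nhds (hsub hX₀)))
        (hε.trans_le (hΦdet X₀ hX₀Ω)).ne'
    exact (hf_conv.le_of_isLocalMax hlocf q).trans (le_of_lt hq)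
  exact ⟨hle, fun X hX => hf_conv.mem_closure_lt hq (hle X hX)⟩
end

section
/- Let X be a topological space and let A, B ⊆ X be open preconnected sets with equal topological boundaries, frontier A = frontier B. If A ∩ B is nonempty, then A = B. -/
/-- A preconnected set that meets an open set and misses its frontier is contained in it. -/
theorem IsPreconnected.subset_of_disjoint_frontier {X : Type*} [TopologicalSpace X] {s u : Set X}
    (hs : IsPreconnected s) (hu : IsOpen u) (hne : (s ∩ u).Nonempty)
    (hd : Disjoint (frontier u) s) : s ⊆ u := by
  refine hs.subset_of_closure_inter_subset hu hne fun x hx => ?_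
  by_contra hxu
  exact Set.disjoint_left.mp hd (hu.frontier_eq ▸ ⟨hx.1, hxu⟩) hx.2

/-- **Clopen argument of Lemma A.3 (th:trivial_lemma).** Two open preconnected sets with
the same topological boundary that intersect must coincide. -/
theorem stmt_8 {X : Type*} [TopologicalSpace X] (A B : Set X)
    (hA : IsOpen A) (hB : IsOpen B)
    (hAc : IsPreconnected A) (hBc : IsPreconnected B)
    (hfr : frontier A = frontier B) (hne : (A ∩ B).Nonempty) :
    A = B := by
  apply Set.Subset.antisymm
  · exact hAc.subset_of_disjoint_frontier hB hne (hfr ▸ disjoint_frontier_iff_isOpen.mpr hA)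
  · exact hBc.subset_of_disjoint_frontier hA (Set.inter_comm A B ▸ hne)
      (hfr ▸ disjoint_frontier_iff_isOpen.mpr hB)
end

section
/- Let μ_min ≥ 2 and ε ∈ (0,1), set μ_max = ε^{-2} μ_min, μ̄ = √(μ_min μ_max), and δ = ε/(1+ε). For μ ∈ [μ_min, μ_max] let c_μ = (μ̄ − μ)/μ, define Φ_μ : [0,1] → ℝ by Φ_μ(X) = (1 + c_μ) X for 0 ≤ X < δ and Φ_μ(X) = X + c_μ δ (1 − X)/(1 − δ) for δ ≤ X ≤ 1, and define u_μ : ℝ → ℝ by u_μ(x) = ( e^{−μ x} + e^{μ (x − 2)} ) / (1 + e^{−2 μ}). Then for every μ ∈ [μ_min, μ_max], ‖ u_μ̄ − u_μ ∘ Φ_μ ‖_{L²(0,1)} ≤ (1+ε)^{−1/2} · exp( −μ_min/(1+ε) ) + e^{−μ_min} / (1 + e^{−2 μ_min}). -/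
open MeasureTheory in
/-- A real function on `(0, 1)` dominated by `D` to the left of `δ` and by `P + D` to the right
has `L²` norm at most `P √(1 - δ) + D`. -/
theorem sqrt_setIntegral_sq_le_of_abs_le {f : ℝ → ℝ} {δ P D : ℝ} (hδ0 : 0 < δ) (hδ1 : δ < 1)
    (hP : 0 ≤ P) (hD : 0 ≤ D) (hleft : ∀ x, 0 < x → x < δ → |f x| ≤ D)
    (hright : ∀ x, δ ≤ x → x < 1 → |f x| ≤ P + D) :
    Real.sqrt (∫ x in Set.Ioo (0 : ℝ) 1, f x ^ 2) ≤ P * Real.sqrt (1 - δ) + D := by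
  have hconst (C : ℝ) : IntegrableOn (fun _ : ℝ => C) (Set.Ioo 0 1) := by simp
  have hind : IntegrableOn ((Set.Ici δ).indicator fun _ => P ^ 2 + 2 * P * D)
      (Set.Ioo (0 : ℝ) 1) := (hconst _).indicator measurableSet_Ici
  have hle : ∫ x in Set.Ioo (0 : ℝ) 1, f x ^ 2 ≤
      ∫ x in Set.Ioo (0 : ℝ) 1, (D ^ 2 + (Set.Ici δ).indicator (fun _ => P ^ 2 + 2 * P * D) x) := by
    refine integral_mono_of_nonneg (Filter.Eventually.of_forall fun x => sq_nonneg (f x))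
      ((hconst _).add hind) ?_
    refine (ae_restrict_iff' measurableSet_Ioo).2 (Filter.Eventually.of_forall fun x hx => ?_)
    rcases lt_or_ge x δ with h | h
    · have h1 := hleft x hx.1 h
      simpa [h] using sq_le_sq' (abs_le.1 h1).1 (abs_le.1 h1).2
    · have h1 := hright x h hx.2
      have h2 := sq_le_sq' (abs_le.1 h1).1 (abs_le.1 h1).2
      simp only [Set.mem_Ici, h, Set.indicator_of_mem]
      linarith [h2, add_sq P D]
  have hinter : Set.Ioo (0 : ℝ) 1 ∩ Set.Ici δ = Set.Ico δ 1 := by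
    ext x
    simp only [Set.mem_inter_iff, Set.mem_Ioo, Set.mem_Ici, Set.mem_Ico]
    constructor
    · rintro ⟨⟨_, h⟩, h'⟩
      exact ⟨h', h⟩
    · rintro ⟨h', h⟩
      exact ⟨⟨by linarith, h⟩, h'⟩
  have hval : ∫ x in Set.Ioo (0 : ℝ) 1,
      (D ^ 2 + (Set.Ici δ).indicator (fun _ => P ^ 2 + 2 * P * D) x) =
      D ^ 2 + (1 - δ) * (P ^ 2 + 2 * P * D) := by
    rw [integral_add (hconst _) hind, setIntegral_indicator measurableSet_Ici, hinter]
    simp [hδ1.le]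
  rw [hval] at hle
  have hs : Real.sqrt (1 - δ) ^ 2 = 1 - δ := Real.sq_sqrt (by linarith)
  have hs1 : 1 - δ ≤ Real.sqrt (1 - δ) := by
    have : Real.sqrt (1 - δ) ≤ 1 := Real.sqrt_le_one.2 (by linarith)
    nlinarith [Real.sqrt_nonneg (1 - δ)]
  refine Real.sqrt_le_iff.2 ⟨by positivity, hle.trans ?_⟩
  nlinarith [mul_le_mul_of_nonneg_left hs1 (mul_nonneg hP hD)]

/-- The boundary-layer profile with parameter `ν` in the stretched variable `z = ν x`. -/
noncomputable def boundaryLayerProfile (ν z : ℝ) : ℝ :=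
  (Real.exp (-z) + Real.exp (z - 2 * ν)) / (1 + Real.exp (-(2 * ν)))

theorem boundaryLayerProfile_nonneg (ν z : ℝ) : 0 ≤ boundaryLayerProfile ν z := by
  unfold boundaryLayerProfile
  positivity

theorem boundaryLayerProfile_anti {ν a z : ℝ} (haz : a ≤ z) (hz : z ≤ ν) :
    boundaryLayerProfile ν z ≤ boundaryLayerProfile ν a := by
  have key (y : ℝ) : Real.exp (-y) + Real.exp (y - 2 * ν) =
      2 * Real.exp (-ν) * Real.cosh (ν - y) := by
    have h1 : Real.exp (-y) = Real.exp (-ν) * Real.exp (ν - y) := by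
      rw [← Real.exp_add]; ring_nf
    have h2 : Real.exp (y - 2 * ν) = Real.exp (-ν) * Real.exp (-(ν - y)) := by
      rw [← Real.exp_add]; ring_nf
    rw [Real.cosh_eq, h1, h2]
    ring
  unfold boundaryLayerProfile
  rw [key, key]
  have : Real.cosh (ν - z) ≤ Real.cosh (ν - a) := by
    rw [Real.cosh_le_cosh, abs_of_nonneg (by linarith), abs_of_nonneg (by linarith)]
    linarith
  gcongr

/-- The profile exceeds the pure exponential `exp (-z)` by at most
`exp (-m) / (1 + exp (-2 m))`. -/
theorem boundaryLayerProfile_sub_exp_mem_Icc {m ν z : ℝ} (hz0 : 0 ≤ z) (hzm : z ≤ m)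
    (hmν : m ≤ ν) :
    boundaryLayerProfile ν z - Real.exp (-z) ∈
      Set.Icc 0 (Real.exp (-m) / (1 + Real.exp (-(2 * m)))) := by
  have hform : boundaryLayerProfile ν z - Real.exp (-z) =
      (Real.exp z - Real.exp (-z)) * (Real.exp (-(2 * ν)) / (1 + Real.exp (-(2 * ν)))) := by
    have : Real.exp (z - 2 * ν) = Real.exp z * Real.exp (-(2 * ν)) := by
      rw [← Real.exp_add]; ring_nf
    unfold boundaryLayerProfile
    rw [this]
    field_simp
    ring
  have hdiff : 0 ≤ Real.exp z - Real.exp (-z) :=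
    sub_nonneg.2 (Real.exp_le_exp.2 (by linarith))
  have hle : Real.exp z - Real.exp (-z) ≤ Real.exp m := by
    linarith [Real.exp_pos (-z), Real.exp_le_exp.2 hzm]
  have hq : Real.exp (-(2 * ν)) / (1 + Real.exp (-(2 * ν))) ≤
      Real.exp (-(2 * m)) / (1 + Real.exp (-(2 * m))) := by
    rw [div_le_div_iff₀ (by positivity) (by positivity)]
    have : Real.exp (-(2 * ν)) ≤ Real.exp (-(2 * m)) := Real.exp_le_exp.2 (by linarith)
    linarith
  have hm : Real.exp (-m) = Real.exp m * Real.exp (-(2 * m)) := by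
    rw [← Real.exp_add]; ring_nf
  rw [hform]
  refine ⟨by positivity, ?_⟩
  rw [hm, mul_div_assoc]
  exact mul_le_mul hle hq (by positivity) (by positivity)

/-- **Kolmogorov N–M width estimate (3.6) for the boundary-layer manifold.** With
`μ_min ≥ 2`, `μ_max = μ_min/ε²`, `μ̄ = √(μ_min μ_max)`, `δ = ε/(1+ε)`, the piecewise-linear
map `Φ_μ`, and the boundary-layer solution `u_μ(x) = (e^{−μx} + e^{μ(x−2)})/(1+e^{−2μ})`,
for every `μ ∈ [μ_min, μ_max]`,
`‖u_μ̄ − u_μ ∘ Φ_μ‖_{L²(0,1)} ≤ (1+ε)^{−1/2} exp(−μ_min/(1+ε)) + e^{−μ_min}/(1+e^{−2μ_min})`. -/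
theorem stmt_13 (μmin ε : ℝ) (hμmin : 2 ≤ μmin) (hε : ε ∈ Set.Ioo (0 : ℝ) 1)
    (μmax μbar δ : ℝ)
    (hμmax : μmax = μmin / ε ^ 2)
    (hμbar : μbar = Real.sqrt (μmin * μmax))
    (hδ : δ = ε / (1 + ε))
    (c : ℝ → ℝ) (hc : ∀ μ, c μ = (μbar - μ) / μ)
    (Φ : ℝ → ℝ → ℝ)
    (hΦ : ∀ μ X, (0 ≤ X → X < δ → Φ μ X = (1 + c μ) * X) ∧
      (δ ≤ X → X ≤ 1 → Φ μ X = X + c μ * δ * (1 - X) / (1 - δ)))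
    (u : ℝ → ℝ → ℝ)
    (hu : ∀ μ x, u μ x =
      (Real.exp (-(μ * x)) + Real.exp (μ * (x - 2))) / (1 + Real.exp (-(2 * μ)))) :
    ∀ μ ∈ Set.Icc μmin μmax,
      Real.sqrt (∫ x in Set.Ioo (0 : ℝ) 1, (u μbar x - u μ (Φ μ x)) ^ 2) ≤
        Real.exp (-(μmin / (1 + ε))) / Real.sqrt (1 + ε) +
          Real.exp (-μmin) / (1 + Real.exp (-(2 * μmin))) := by
  rintro μ ⟨hμ1, -⟩
  obtain ⟨hε0, hε1⟩ := hε
  have hm0 : 0 < μmin := by linarith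
  have hμ0 : 0 < μ := by linarith
  have hb : μbar = μmin / ε := by
    rw [hμbar, hμmax, show μmin * (μmin / ε ^ 2) = (μmin / ε) ^ 2 by ring]
    exact Real.sqrt_sq (by positivity)
  have hbm : μmin ≤ μbar := by
    rw [hb, le_div_iff₀ hε0]
    nlinarith
  have hb0 : 0 < μbar := by linarith
  have hδ0 : 0 < δ := by rw [hδ]; positivity
  have h1δ : 1 - δ = 1 / (1 + ε) := by rw [hδ]; field_simp; ring
  have hδ1 : δ < 1 := by
    have : 0 < 1 / (1 + ε) := by positivity
    linarith
  have hbδ : μbar * δ = μmin / (1 + ε) := by rw [hb, hδ]; field_simp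
  have ham : μmin / (1 + ε) ≤ μmin := div_le_self hm0.le (by linarith)
  have ha0 : 0 ≤ μmin / (1 + ε) := by positivity
  have huF (ν x : ℝ) : u ν x = boundaryLayerProfile ν (ν * x) := by
    rw [hu, boundaryLayerProfile]
    ring_nf
  have hfirst : Real.exp (-(μmin / (1 + ε))) / Real.sqrt (1 + ε) =
      Real.exp (-(μmin / (1 + ε))) * Real.sqrt (1 - δ) := by
    rw [h1δ, Real.sqrt_div zero_le_one, Real.sqrt_one, mul_one_div]
  rw [hfirst]
  refine sqrt_setIntegral_sq_le_of_abs_le hδ0 hδ1 (by positivity) (by positivity) ?_ ?_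
  · intro x hx0 hxδ
    have hz : μ * Φ μ x = μbar * x := by
      rw [(hΦ μ x).1 hx0.le hxδ, hc]
      field_simp
      ring
    rw [huF, huF, hz]
    have hxm : μbar * x ≤ μmin := by
      have := mul_le_mul_of_nonneg_left hxδ.le hb0.le
      linarith
    have h1 := boundaryLayerProfile_sub_exp_mem_Icc (by positivity) hxm hbm
    have h2 := boundaryLayerProfile_sub_exp_mem_Icc (by positivity) hxm hμ1
    rw [abs_le]
    constructor <;> linarith [h1.1, h1.2, h2.1, h2.2]
  · intro x hδx hx1
    have hz : μ * Φ μ x = μ - (1 - x) * (μ * (1 + ε) - μmin) := by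
      rw [(hΦ μ x).2 hδx hx1.le, hc, mul_div_assoc, mul_assoc, h1δ, hδ, hb]
      field_simp
      ring
    have hk : 0 ≤ μ * (1 + ε) - μmin := by nlinarith
    have hks : (1 - δ) * (μ * (1 + ε) - μmin) = μ - μmin / (1 + ε) := by
      rw [h1δ]
      field_simp
    have hz1 : μ * Φ μ x ≤ μ := by
      rw [hz]
      nlinarith
    have hza : μmin / (1 + ε) ≤ μ * Φ μ x := by
      rw [hz]
      nlinarith [mul_nonneg (sub_nonneg.2 hδx) hk]
    have hxa : μmin / (1 + ε) ≤ μbar * x := by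
      rw [← hbδ]
      gcongr
    have hxb : μbar * x ≤ μbar := by nlinarith
    rw [huF, huF]
    have h1 := boundaryLayerProfile_anti hxa hxb
    have h2 := boundaryLayerProfile_anti hza hz1
    have h3 := (boundaryLayerProfile_sub_exp_mem_Icc ha0 ham hbm).2
    have h4 := (boundaryLayerProfile_sub_exp_mem_Icc ha0 ham hμ1).2
    have h5 := boundaryLayerProfile_nonneg μbar (μbar * x)
    have h6 := boundaryLayerProfile_nonneg μ (μ * Φ μ x)
    rw [abs_le]
    constructor <;> linarith
end

section
/- For t ∈ [1/3, 2/3] define Φ_t : [0,1] → ℝ by Φ_t(X) = X + (t − 1/2)(1 − |2X − 1|). Then: (a) Φ_t is strictly increasing and maps [0,1] bijectively onto [0,1]; and (b) for every X ∈ [0,1], sign(Φ_t(X) − t) = sign(2X − 1), where sign(s) equals 1 for s > 0, −1 for s < 0, and 0 for s = 0. Consequently, for the parametric family u(x; t) = sign(x − t), the mapped field satisfies u(Φ_t(X); t) = sign(2X − 1) for all X ∈ [0,1] and all t ∈ [1/3, 2/3], i.e. it is independent of t. -/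
theorem Real.sign_mul_of_pos {c : ℝ} (hc : 0 < c) (x : ℝ) : Real.sign (c * x) = Real.sign x := by
  rcases lt_trichotomy x 0 with hx | rfl | hx
  · rw [Real.sign_of_neg hx, Real.sign_of_neg (mul_neg_of_pos_of_neg hc hx)]
  · rw [mul_zero]
  · rw [Real.sign_of_pos hx, Real.sign_of_pos (mul_pos hc hx)]

/-- **Shock-wave example (Appendix B.2).** For `t ∈ [1/3, 2/3]` the map
`Φ_t(X) = X + (t − 1/2)(1 − |2X − 1|)` is strictly increasing and bijective from `[0,1]`
onto `[0,1]`, `sign(Φ_t(X) − t) = sign(2X − 1)` on `[0,1]`, and consequently for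
`u(x;t) = sign(x − t)` the mapped field `u(Φ_t(X); t) = sign(2X − 1)` is independent
of `t`. -/
theorem stmt_15 (Φ : ℝ → ℝ → ℝ)
    (hΦ : ∀ t X, Φ t X = X + (t - 1 / 2) * (1 - |2 * X - 1|))
    (u : ℝ → ℝ → ℝ)
    (hu : ∀ x t, u x t = Real.sign (x - t)) :
    ∀ t ∈ Set.Icc (1 / 3 : ℝ) (2 / 3),
      StrictMonoOn (Φ t) (Set.Icc 0 1) ∧
      Set.BijOn (Φ t) (Set.Icc 0 1) (Set.Icc 0 1) ∧
      (∀ X ∈ Set.Icc (0 : ℝ) 1, Real.sign (Φ t X - t) = Real.sign (2 * X - 1)) ∧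
      (∀ X ∈ Set.Icc (0 : ℝ) 1, u (Φ t X) t = Real.sign (2 * X - 1)) := by
  rintro t ⟨ht₁, ht₂⟩
  have left : ∀ X ≤ 1 / 2, Φ t X = t + t * (2 * X - 1) := fun X hX => by
    rw [hΦ, abs_of_nonpos (by linarith)]; ring
  have right : ∀ X ≥ 1 / 2, Φ t X = t + (1 - t) * (2 * X - 1) := fun X hX => by
    rw [hΦ, abs_of_nonneg (by linarith)]; ring
  have mono : StrictMono (Φ t) := by
    refine StrictMonoOn.Iic_union_Ici (a := 1 / 2) ?_ ?_
    · intro X hX Y hY hXY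
      rw [left X hX, left Y hY]
      nlinarith
    · intro X hX Y hY hXY
      rw [right X hX, right Y hY]
      nlinarith
  have h0 : Φ t 0 = 0 := by rw [left 0 (by norm_num)]; ring
  have h1 : Φ t 1 = 1 := by rw [right 1 (by norm_num)]; ring
  have cont : Continuous (Φ t) := by
    rw [show Φ t = _ from funext (hΦ t)]
    fun_prop
  have sign_eq : ∀ X, Real.sign (Φ t X - t) = Real.sign (2 * X - 1) := fun X => by
    rcases le_total X (1 / 2) with hX | hX
    · rw [left X hX, add_sub_cancel_left, Real.sign_mul_of_pos (by linarith)]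
    · rw [right X hX, add_sub_cancel_left, Real.sign_mul_of_pos (by linarith)]
  refine ⟨mono.strictMonoOn _, ⟨?_, mono.injective.injOn, ?_⟩, fun X _ => sign_eq X,
    fun X _ => (hu _ _).trans (sign_eq X)⟩
  · rintro X ⟨hX₀, hX₁⟩
    exact ⟨h0 ▸ mono.monotone hX₀, h1 ▸ mono.monotone hX₁⟩
  · have surj := intermediate_value_Icc zero_le_one cont.continuousOn
    rwa [h0, h1] at surj
end

section
/- Let K ≥ 0 and let Λ : ℝ → ℝ satisfy |Λ(x) − Λ(y)| ≤ K |x − y| for all x, y ∈ [0,1] and Λ([0,1]) ⊆ (0,1). Let n ≥ 2, let m = min_{x ∈ [0,1]} Λ(x) and M = max_{x ∈ [0,1]} Λ(x), and define grid values ȳ_j = m + (j−1)(M − m)/(n−1) for j = 1, …, n. Define u : (0,1)² → ℝ by u(X) = 1 if X₂ ≥ Λ(X₁) and u(X) = 0 otherwise, and for i, j ∈ {1,…,n} define ζ_{ij} : (0,1)² → ℝ by ζ_{ij}(X) = 1 if X₁ ∈ ((i−1)/n, i/n) and X₂ > ȳ_j, and ζ_{ij}(X) = 0 otherwise. Then there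 exist coefficients α ∈ ℝ^{n×n} such that ∫_{(0,1)²} | u(X) − Σ_{i,j=1}^{n} α_{ij} ζ_{ij}(X) | dX ≤ (M − m + K)/n. -/
open MeasureTheory

/-- A uniform grid of `n` points on `[m, M]` comes within `(M - m) / n` of every point. -/
lemma exists_uniform_grid_near {n : ℕ} (hn : 2 ≤ n) {m M v : ℝ} (hmv : m ≤ v) (hvM : v ≤ M) :
    ∃ j : Fin n, |m + (j : ℝ) * (M - m) / (n - 1) - v| ≤ (M - m) / n := by
  have hn' : (2 : ℝ) ≤ n := by exact_mod_cast hn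
  rcases (hmv.trans hvM).eq_or_lt with h | h
  · refine ⟨⟨0, by omega⟩, ?_⟩
    have : v = m := by linarith
    simp [this, ← h]
  have hd : 0 < M - m := sub_pos.2 h
  have hn1 : (0 : ℝ) < n - 1 := by linarith
  set t : ℝ := (v - m) * (n - 1) / (M - m) with ht
  have ht0 : 0 ≤ t := div_nonneg (mul_nonneg (by linarith) hn1.le) hd.le
  have ht1 : t ≤ n - 1 := by
    rw [ht, div_le_iff₀ hd]
    nlinarith
  have hv : v = m + t * (M - m) / (n - 1) := by
    rw [ht]
    field_simp
    ring
  have hle : (⌊t + 1 / 2⌋₊ : ℝ) ≤ t + 1 / 2 := Nat.floor_le (by linarith)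
  have hlt : t + 1 / 2 < ⌊t + 1 / 2⌋₊ + 1 := Nat.lt_floor_add_one _
  have hj : ⌊t + 1 / 2⌋₊ < n := by
    have : (⌊t + 1 / 2⌋₊ : ℝ) < n := by linarith
    exact_mod_cast this
  refine ⟨⟨⌊t + 1 / 2⌋₊, hj⟩, ?_⟩
  have heq : m + (⌊t + 1 / 2⌋₊ : ℝ) * (M - m) / (n - 1) - v
      = (⌊t + 1 / 2⌋₊ - t) * ((M - m) / (n - 1)) := by
    rw [hv]
    ring
  have habs : |(⌊t + 1 / 2⌋₊ : ℝ) - t| ≤ 1 / 2 := abs_le.2 ⟨by linarith, by linarith⟩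
  calc |m + (⌊t + 1 / 2⌋₊ : ℝ) * (M - m) / (n - 1) - v|
      = |(⌊t + 1 / 2⌋₊ : ℝ) - t| * ((M - m) / (n - 1)) := by
        rw [heq, abs_mul, abs_of_pos (div_pos hd hn1)]
    _ ≤ 1 / 2 * ((M - m) / (n - 1)) := by gcongr
    _ ≤ (M - m) / n := by
        rw [div_mul_div_comm, div_le_div_iff₀ (by linarith) (by linarith)]
        nlinarith

/-- The `L¹` distance between the indicators of two upper half-lines is at most the distance
of their endpoints. -/
lemma setIntegral_abs_sub_indicator_le (s : Set ℝ) (a b : ℝ) :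
    ∫ y in s, |(if a ≤ y then (1 : ℝ) else 0) - (if b < y then 1 else 0)| ≤ |b - a| := by
  have hint : Integrable ((Set.uIcc a b).indicator fun _ => (1 : ℝ)) :=
    (integrable_indicator_iff measurableSet_uIcc).2 (integrableOn_const (by simp))
  calc ∫ y in s, |(if a ≤ y then (1 : ℝ) else 0) - (if b < y then 1 else 0)|
      ≤ ∫ y in s, (Set.uIcc a b).indicator (fun _ => (1 : ℝ)) y := by
        refine integral_mono_of_nonneg (.of_forall fun _ => abs_nonneg _) hint.restrict
          (.of_forall fun y => ?_)
        by_cases hy : y ∈ Set.uIcc a b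
        · rw [Set.indicator_of_mem hy]
          beta_reduce
          split_ifs <;> norm_num
        · rw [Set.indicator_of_notMem hy]
          rw [Set.mem_uIcc] at hy
          push Not at hy
          beta_reduce
          split_ifs with h1 h2 h2
          · norm_num
          · exact absurd (hy.1 h1) h2
          · exact absurd (hy.2 h2.le) (by linarith)
          · norm_num
    _ ≤ ∫ y, (Set.uIcc a b).indicator (fun _ => (1 : ℝ)) y :=
        setIntegral_le_integral hint
          (.of_forall fun y => Set.indicator_nonneg (fun _ _ => zero_le_one) y)
    _ = |b - a| := by
        rw [integral_indicator measurableSet_uIcc]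
        simp [Measure.real, Real.volume_interval]

/-- Almost every point of `(0, 1)` lies in one of the `n` open strips of width `1 / n`. -/
lemma ae_exists_mem_Ioo_div {n : ℕ} (hn : 0 < n) :
    ∀ᵐ x ∂(volume.restrict (Set.Ioo (0 : ℝ) 1)),
      ∃ i : Fin n, x ∈ Set.Ioo ((i : ℝ) / n) (((i : ℝ) + 1) / n) := by
  have hn' : (0 : ℝ) < n := by exact_mod_cast hn
  have hc : (Set.range fun k : ℕ => (k : ℝ) / n).Countable := Set.countable_range _
  filter_upwards [ae_restrict_mem measurableSet_Ioo, ae_restrict_of_ae (hc.ae_notMem volume)]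
    with x hx hxn
  have hle : (⌊x * n⌋₊ : ℝ) ≤ x * n := Nat.floor_le (mul_nonneg hx.1.le hn'.le)
  have hi : ⌊x * n⌋₊ < n := by
    have : (⌊x * n⌋₊ : ℝ) < n := hle.trans_lt (by nlinarith [hx.2])
    exact_mod_cast this
  refine ⟨⟨⌊x * n⌋₊, hi⟩, lt_of_le_of_ne ?_ fun h => hxn ⟨_, h⟩, ?_⟩
  · exact (div_le_iff₀ hn').2 hle
  · exact (lt_div_iff₀ hn').2 (Nat.lt_floor_add_one _)

/-- The open strips of width `1 / n` are pairwise disjoint. -/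
lemma eq_of_mem_Ioo_div {n : ℕ} {i k : Fin n} {x : ℝ}
    (hi : x ∈ Set.Ioo ((i : ℝ) / n) (((i : ℝ) + 1) / n))
    (hk : x ∈ Set.Ioo ((k : ℝ) / n) (((k : ℝ) + 1) / n)) : k = i := by
  have hn : (0 : ℝ) < n := by exact_mod_cast i.pos
  have h1 := (div_lt_div_iff_of_pos_right hn).1 (hi.1.trans hk.2)
  have h2 := (div_lt_div_iff_of_pos_right hn).1 (hk.1.trans hi.2)
  norm_cast at h1 h2
  exact Fin.ext (by omega)

/-- **Approximation estimate (B.4) of Appendix B.3.** Let `Λ : ℝ → ℝ` be `K`-Lipschitz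
on `[0,1]` with `Λ([0,1]) ⊆ (0,1)`, let `n ≥ 2`, let `m` and `M` be the minimum and
maximum of `Λ` on `[0,1]`, and let `ȳ_j = m + j(M−m)/(n−1)` for `j = 0,…,n−1`. For the
indicator field `u(X) = 1_{X₂ ≥ Λ(X₁)}` and the piecewise-constant basis
`ζ_{ij}(X) = 1_{X₁ ∈ (i/n,(i+1)/n), X₂ > ȳ_j}`, there exist coefficients `α` with
`∫_{(0,1)²} |u − Σ_{ij} α_{ij} ζ_{ij}| ≤ (M − m + K)/n`. -/
theorem stmt_17 (K : ℝ) (hK : 0 ≤ K) (Λ : ℝ → ℝ)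
    (hLip : ∀ x ∈ Set.Icc (0 : ℝ) 1, ∀ y ∈ Set.Icc (0 : ℝ) 1, |Λ x - Λ y| ≤ K * |x - y|)
    (hrange : ∀ x ∈ Set.Icc (0 : ℝ) 1, Λ x ∈ Set.Ioo (0 : ℝ) 1)
    (n : ℕ) (hn : 2 ≤ n)
    (m M : ℝ)
    (hm : IsLeast (Λ '' Set.Icc 0 1) m)
    (hM : IsGreatest (Λ '' Set.Icc 0 1) M)
    (ybar : Fin n → ℝ)
    (hybar : ∀ j : Fin n, ybar j = m + (j : ℝ) * (M - m) / (n - 1))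
    (u : ℝ × ℝ → ℝ)
    (hu : ∀ X : ℝ × ℝ, u X = if Λ X.1 ≤ X.2 then 1 else 0)
    (ζ : Fin n → Fin n → ℝ × ℝ → ℝ)
    (hζ : ∀ (i j : Fin n) (X : ℝ × ℝ),
      ζ i j X = if X.1 ∈ Set.Ioo ((i : ℝ) / n) (((i : ℝ) + 1) / n) ∧ ybar j < X.2
        then 1 else 0) :
    ∃ α : Fin n → Fin n → ℝ,
      (∫ X in (Set.Ioo (0 : ℝ) 1) ×ˢ (Set.Ioo (0 : ℝ) 1),
          |u X - ∑ i, ∑ j, α i j * ζ i j X|) ≤ (M - m + K) / n := by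
  have hn' : (2 : ℝ) ≤ n := by exact_mod_cast hn
  have hn0 : (0 : ℝ) < n := by linarith
  have hmM : m ≤ M := hM.2 hm.1
  have hB : 0 ≤ (M - m + K) / n := div_nonneg (by linarith) hn0.le
  have hnode (i : Fin n) : (i : ℝ) / n ∈ Set.Icc (0 : ℝ) 1 := by
    have : (i : ℝ) ≤ n := by exact_mod_cast i.2.le
    exact ⟨by positivity, (div_le_one hn0).2 this⟩
  have hex (i : Fin n) : ∃ j : Fin n, |ybar j - Λ (i / n)| ≤ (M - m) / n := by
    simp only [hybar]
    exact exists_uniform_grid_near hn (hm.2 ⟨_, hnode i, rfl⟩) (hM.2 ⟨_, hnode i, rfl⟩)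
  choose J hJ using hex
  refine ⟨fun i j => if j = J i then 1 else 0, ?_⟩
  simp only [ite_mul, one_mul, zero_mul, Finset.sum_ite_eq', Finset.mem_univ, if_true]
  by_cases hint : IntegrableOn (fun X => |u X - ∑ i, ζ i (J i) X|)
      (Set.Ioo (0 : ℝ) 1 ×ˢ Set.Ioo (0 : ℝ) 1)
  swap
  · rw [integral_undef hint]
    exact hB
  rw [Measure.volume_eq_prod] at hint ⊢
  rw [setIntegral_prod _ hint]
  have hinner : ∀ᵐ x ∂(volume.restrict (Set.Ioo (0 : ℝ) 1)),
      ∫ y in Set.Ioo (0 : ℝ) 1, |u (x, y) - ∑ i, ζ i (J i) (x, y)| ≤ (M - m + K) / n := by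
    filter_upwards [ae_restrict_mem measurableSet_Ioo, ae_exists_mem_Ioo_div (n := n) (by omega)]
      with x hx hxi
    obtain ⟨i, hi⟩ := hxi
    have hsum (y : ℝ) : ∑ k, ζ k (J k) (x, y) = if ybar (J i) < y then 1 else 0 := by
      rw [Finset.sum_eq_single i]
      · simp [hζ, hi.1, hi.2]
      · intro k _ hki
        rw [hζ, if_neg]
        exact fun h => hki (eq_of_mem_Ioo_div hi h.1)
      · simp
    simp only [hsum, hu]
    refine (setIntegral_abs_sub_indicator_le _ _ _).trans ?_
    have hxd : |(i : ℝ) / n - x| ≤ 1 / n := by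
      have h2 := hi.2
      rw [add_div] at h2
      rw [abs_sub_comm, abs_of_pos (sub_pos.2 hi.1)]
      linarith
    calc |ybar (J i) - Λ x|
        ≤ |ybar (J i) - Λ (i / n)| + |Λ (i / n) - Λ x| := abs_sub_le _ _ _
      _ ≤ (M - m) / n + K * (1 / n) := by
          refine add_le_add (hJ i) ((hLip _ (hnode i) _ (Set.Ioo_subset_Icc_self hx)).trans ?_)
          gcongr
      _ = (M - m + K) / n := by ring
  calc _ ≤ ∫ _ in Set.Ioo (0 : ℝ) 1, (M - m + K) / n :=
        integral_mono_of_nonneg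
          (.of_forall fun _ => integral_nonneg fun _ => abs_nonneg _)
          (integrable_const _) hinner
    _ = (M - m + K) / n := by simp
end
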